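/- Assume a ≤ p_n' ≤ b for all n and 2 < inf_n A_n ≤ sup_n A_n < ∞. Then ν' is exact upper and lower dimensional: there exist constants c1 and c2 such that for ν'-almost every x, liminf_{r→0+} log ν'(B(x,r))/log r = c1 and limsup_{r→0+} log ν'(B(x,r))/log r = c2. -/

import Mathlib

open MeasureTheory Filter Set Metric Topology

/-- `moranCyl c w n (x, ℓ)` refines the interval `[x, x + ℓ]` along the binary word `w`,
using the contraction ratio `c k` at step `k` (the first letter of `w` is processed with
index `n`).  The result `(x', ℓ')` describes the interval `[x', x' + ℓ']`. -/
noncomputable def moranCyl (c : ℕ → ℝ) : List Bool → ℕ → ℝ × ℝ → ℝ × ℝ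
  | [], _, st => st
  | bb :: w, n, st =>
      moranCyl c w (n + 1)
        (if bb then (st.1 + st.2 - st.2 / c n, st.2 / c n) else (st.1, st.2 / c n))

/-- The basic interval `I_w` of the Moran construction with ratios `c`. -/
noncomputable def moranI (c : ℕ → ℝ) (w : List Bool) : Set ℝ :=
  Icc (moranCyl c w 1 (0, 1)).1 ((moranCyl c w 1 (0, 1)).1 + (moranCyl c w 1 (0, 1)).2)

/-- The length `|I_w|` of the basic interval `I_w`. -/
noncomputable def moranLen (c : ℕ → ℝ) (w : List Bool) : ℝ :=
  (moranCyl c w 1 (0, 1)).2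

/-- The Moran set `⋂ n ⋃ {I_w : |w| = n}`. -/
noncomputable def moranSet (c : ℕ → ℝ) : Set ℝ :=
  ⋂ n : ℕ, ⋃ w ∈ {w : List Bool | w.length = n}, moranI c w

/-- The mass assigned to the cylinder `I_w` by the Moran measure with weight `r k` for the
letter at step `k`: `cylMass r w 1 1 = μ(I_w)`. -/
noncomputable def cylMass (r : ℕ → ℝ) : List Bool → ℕ → ℝ → ℝ
  | [], _, m => m
  | bb :: w, n, m => cylMass r w (n + 1) (if bb then (1 - r n) * m else r n * m)

/-- Lower local dimension `liminf_{r → 0⁺} log μ(B(x,r)) / log r`. -/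
noncomputable def lowerLocalDim (μ : Measure ℝ) (x : ℝ) : ℝ :=
  liminf (fun rr : ℝ => Real.log (μ (closedBall x rr)).toReal / Real.log rr) (𝓝[>] 0)

/-- Upper local dimension `limsup_{r → 0⁺} log μ(B(x,r)) / log r`. -/
noncomputable def upperLocalDim (μ : Measure ℝ) (x : ℝ) : ℝ :=
  limsup (fun rr : ℝ => Real.log (μ (closedBall x rr)).toReal / Real.log rr) (𝓝[>] 0)

/-- `betaFn ρ C s = -log (ρ^s + (1-ρ)^s) / log C`; so `β₁ = betaFn p A`, `β₂ = betaFn q B`. -/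
noncomputable def betaFn (ρ C : ℝ) (s : ℝ) : ℝ :=
  -Real.log (ρ ^ s + (1 - ρ) ^ s) / Real.log C

/-- The Legendre transform `f^*(α) = inf_s (s α - f(s))`. -/
noncomputable def legendre (f : ℝ → ℝ) (α : ℝ) : ℝ :=
  ⨅ s : ℝ, (s * α - f s)

/-- The modification `β̃₁` of `β₁`, linear on `(0,1)`. -/
noncomputable def betaTilde1 (ρ C : ℝ) (s : ℝ) : ℝ :=
  if s ≤ 0 ∨ 1 ≤ s then betaFn ρ C s
  else (1 - s) * betaFn ρ C 0 + s * betaFn ρ C 1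

/-- `packSup μ X r s` is the supremum of `∑ᵢ μ(B(xᵢ,r))^s` over all finite families of
pairwise disjoint closed balls of radius `r` with centers in `X`. -/
noncomputable def packSup (μ : Measure ℝ) (X : Set ℝ) (rr s : ℝ) : ℝ :=
  sSup {y : ℝ | ∃ t : Finset ℝ, (↑t : Set ℝ) ⊆ X ∧
    (↑t : Set ℝ).Pairwise (fun u v => Disjoint (closedBall u rr) (closedBall v rr)) ∧
    y = ∑ u ∈ t, (μ (closedBall u rr)).toReal ^ s}


/-- The binary words of length `n`. -/
def binaryWords : ℕ → Finset (List Bool)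
  | 0 => {[]}
  | n + 1 => (binaryWords n).image (List.cons true) ∪ (binaryWords n).image (List.cons false)

theorem length_of_mem_binaryWords {n : ℕ} {w : List Bool} (hw : w ∈ binaryWords n) :
    w.length = n := by
  induction n generalizing w with
  | zero => simp_all [binaryWords]
  | succ n ih =>
    simp only [binaryWords, Finset.mem_union, Finset.mem_image] at hw
    rcases hw with ⟨u, hu, rfl⟩ | ⟨u, hu, rfl⟩ <;> simp [ih hu]

theorem sum_binaryWords_succ (n : ℕ) (f : List Bool → ℝ) :
    ∑ w ∈ binaryWords (n + 1), f w =
      ∑ w ∈ binaryWords n, f (true :: w) + ∑ w ∈ binaryWords n, f (false :: w) := by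
  rw [binaryWords, Finset.sum_union, Finset.sum_image (by simp), Finset.sum_image (by simp)]
  rw [Finset.disjoint_left]
  simp

theorem cylMass_pos {r : ℕ → ℝ} (h0 : ∀ n, 0 < r n) (h1 : ∀ n, r n < 1) (w : List Bool) (n : ℕ)
    {m : ℝ} (hm : 0 < m) : 0 < cylMass r w n m := by
  induction w generalizing n m with
  | nil => exact hm
  | cons d w ih =>
    refine ih _ ?_
    have h2 : 0 < 1 - r n := sub_pos.2 (h1 n)
    have := h0 n
    split_ifs <;> positivity

theorem sum_cylMass (r : ℕ → ℝ) (N n : ℕ) (m : ℝ) :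
    ∑ w ∈ binaryWords N, cylMass r w n m = m := by
  induction N generalizing n m with
  | zero => simp [binaryWords, cylMass]
  | succ N ih =>
    rw [sum_binaryWords_succ]
    simp only [cylMass, ih, if_true, Bool.false_eq_true, if_false]
    ring

/-- The negative of the entropy of a two-point distribution with weights `ρ` and `1 - ρ`. -/
noncomputable def meanLog (ρ : ℝ) : ℝ := ρ * Real.log ρ + (1 - ρ) * Real.log (1 - ρ)

theorem abs_meanLog_le {ρ H : ℝ} (h0 : 0 < ρ) (h1 : ρ < 1) (hH0 : |Real.log ρ| ≤ H)
    (hH1 : |Real.log (1 - ρ)| ≤ H) : |meanLog ρ| ≤ H := by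
  rw [abs_le] at *
  unfold meanLog
  constructor <;> nlinarith

theorem two_point_moment_le {ρ H t : ℝ} (h0 : 0 < ρ) (h1 : ρ < 1) (hH0 : |Real.log ρ| ≤ H)
    (hH1 : |Real.log (1 - ρ)| ≤ H) (ht : |t| * (2 * H) ≤ 1) :
    (1 - ρ) * Real.exp (t * Real.log (1 - ρ)) + ρ * Real.exp (t * Real.log ρ) ≤
      Real.exp (t * meanLog ρ + 4 * H ^ 2 * t ^ 2) := by
  have hM := abs_meanLog_le h0 h1 hH0 hH1
  have key : ∀ y : ℝ, |y| ≤ H → Real.exp (t * y) ≤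
      Real.exp (t * meanLog ρ) * (1 + t * (y - meanLog ρ) + 4 * H ^ 2 * t ^ 2) := by
    intro y hy
    have hd : |y - meanLog ρ| ≤ 2 * H := (abs_sub _ _).trans (by linarith)
    have hz : |t * (y - meanLog ρ)| ≤ |t| * (2 * H) := by
      rw [abs_mul]; gcongr
    have h3 := (abs_le.1 (Real.abs_exp_sub_one_sub_id_le (hz.trans ht))).2
    have h4 : (t * (y - meanLog ρ)) ^ 2 ≤ 4 * H ^ 2 * t ^ 2 := by
      have := pow_le_pow_left₀ (abs_nonneg _) hz 2
      rw [sq_abs, mul_pow |t|, sq_abs] at this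
      linarith
    rw [show t * y = t * meanLog ρ + t * (y - meanLog ρ) by ring, Real.exp_add]
    gcongr
    linarith
  have k0 := mul_le_mul_of_nonneg_left (key _ hH0) h0.le
  have k1 := mul_le_mul_of_nonneg_left (key _ hH1) (sub_pos.2 h1).le
  have h5 := Real.add_one_le_exp (4 * H ^ 2 * t ^ 2)
  have h6 := mul_le_mul_of_nonneg_left h5 (Real.exp_pos (t * meanLog ρ)).le
  rw [Real.exp_add]
  refine le_trans (add_le_add k1 k0) (le_trans (le_of_eq ?_) h6)
  simp only [meanLog]
  ring

theorem sum_cylMass_mul_exp_le {r : ℕ → ℝ} {H t : ℝ} (h0 : ∀ n, 0 < r n) (h1 : ∀ n, r n < 1)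
    (hH0 : ∀ n, |Real.log (r n)| ≤ H) (hH1 : ∀ n, |Real.log (1 - r n)| ≤ H)
    (ht : |t| * (2 * H) ≤ 1) (N n : ℕ) {m : ℝ} (hm : 0 < m) :
    ∑ w ∈ binaryWords N, cylMass r w n m * Real.exp (t * Real.log (cylMass r w n m)) ≤
      m * Real.exp (t * Real.log m) *
        Real.exp (t * (∑ i ∈ Finset.range N, meanLog (r (n + i))) + 4 * H ^ 2 * t ^ 2 * N) := by
  induction N generalizing n m with
  | zero => simp [binaryWords, cylMass]
  | succ N ih =>
    rw [sum_binaryWords_succ]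
    have h2 : 0 < 1 - r n := sub_pos.2 (h1 n)
    have e1 := ih (n + 1) (mul_pos h2 hm)
    have e2 := ih (n + 1) (mul_pos (h0 n) hm)
    simp only [cylMass, if_true, Bool.false_eq_true, if_false]
    refine (add_le_add e1 e2).trans ?_
    rw [Real.log_mul h2.ne' hm.ne', Real.log_mul (h0 n).ne' hm.ne', mul_add, mul_add,
      Real.exp_add (t * Real.log (1 - r n)), Real.exp_add (t * Real.log (r n)), ← add_mul]
    have h3 := two_point_moment_le (h0 n) (h1 n) (hH0 n) (hH1 n) ht
    rw [Finset.sum_range_succ']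
    have h4 : t * (∑ k ∈ Finset.range N, meanLog (r (n + (k + 1))) + meanLog (r (n + 0))) +
        4 * H ^ 2 * t ^ 2 * ((N + 1 : ℕ) : ℝ) = (t * meanLog (r n) + 4 * H ^ 2 * t ^ 2) +
        (t * (∑ i ∈ Finset.range N, meanLog (r (n + 1 + i))) + 4 * H ^ 2 * t ^ 2 * N) := by
      simp only [add_assoc, add_comm 1, add_zero]
      push_cast
      ring
    rw [h4, Real.exp_add (t * meanLog (r n) + _), ← mul_assoc (m * Real.exp (t * Real.log m))]
    refine mul_le_mul_of_nonneg_right ?_ (Real.exp_pos _).le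
    refine le_trans (le_of_eq ?_) (mul_le_mul_of_nonneg_left h3
      (mul_pos hm (Real.exp_pos (t * Real.log m))).le)
    ring

theorem sum_cylMass_deviation_le {r : ℕ → ℝ} {H ε : ℝ} (h0 : ∀ n, 0 < r n) (h1 : ∀ n, r n < 1)
    (hH0 : ∀ n, |Real.log (r n)| ≤ H) (hH1 : ∀ n, |Real.log (1 - r n)| ≤ H)
    (hH : 1 ≤ H) (hε : 0 < ε) (hε1 : ε ≤ 1) (N n : ℕ) :
    ∑ w ∈ binaryWords N with
        ε * N < |Real.log (cylMass r w n 1) - ∑ i ∈ Finset.range N, meanLog (r (n + i))|,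
      cylMass r w n 1 ≤ 2 * Real.exp (-(ε ^ 2 / (16 * H ^ 2))) ^ N := by
  set S := ∑ i ∈ Finset.range N, meanLog (r (n + i))
  set τ := ε / (8 * H ^ 2) with hτ
  have hτ0 : 0 < τ := by positivity
  have hτ1 : τ * (2 * H) ≤ 1 := by
    rw [hτ, div_mul_eq_mul_div, div_le_one (by positivity)]
    nlinarith
  have ep := sum_cylMass_mul_exp_le h0 h1 hH0 hH1
    (t := τ) (by rwa [abs_of_pos hτ0]) N n one_pos
  have em := sum_cylMass_mul_exp_le h0 h1 hH0 hH1
    (t := -τ) (by rwa [abs_neg, abs_of_pos hτ0]) N n one_pos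
  have hpos := fun w => cylMass_pos h0 h1 w n one_pos
  simp only [Real.log_one, mul_zero, Real.exp_zero, one_mul] at ep em
  have hcoef : 4 * H ^ 2 * τ ^ 2 - τ * ε = -(ε ^ 2 / (16 * H ^ 2)) := by
    rw [hτ]; field_simp; ring
  calc _ ≤ ∑ w ∈ binaryWords N,
        (cylMass r w n 1 * Real.exp (τ * Real.log (cylMass r w n 1)) *
            Real.exp (-(τ * S) - τ * (ε * N)) +
          cylMass r w n 1 * Real.exp (-τ * Real.log (cylMass r w n 1)) *
            Real.exp (τ * S - τ * (ε * N))) := by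
        rw [Finset.sum_filter]
        refine Finset.sum_le_sum fun w _ => ?_
        have hw := hpos w
        split_ifs with h
        · rw [mul_assoc, mul_assoc, ← mul_add, ← Real.exp_add, ← Real.exp_add]
          refine le_mul_of_one_le_right hw.le ?_
          rcases lt_abs.1 h with h | h
          · refine le_add_of_le_of_nonneg (Real.one_le_exp ?_) (Real.exp_pos _).le
            nlinarith
          · refine le_add_of_nonneg_of_le (Real.exp_pos _).le (Real.one_le_exp ?_)
            nlinarith
        · positivity
    _ ≤ Real.exp (τ * S + 4 * H ^ 2 * τ ^ 2 * N) * Real.exp (-(τ * S) - τ * (ε * N)) +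
          Real.exp (-τ * S + 4 * H ^ 2 * (-τ) ^ 2 * N) * Real.exp (τ * S - τ * (ε * N)) := by
        rw [Finset.sum_add_distrib, ← Finset.sum_mul, ← Finset.sum_mul]
        gcongr
    _ = _ := by
        rw [← Real.exp_add, ← Real.exp_add, ← Real.exp_nat_mul, ← hcoef, two_mul]
        congr 2 <;> ring

/-- The common length of the cylinders reached after `N` steps, starting at step `n`. -/
noncomputable def levelLen (c : ℕ → ℝ) (n N : ℕ) : ℝ := ∏ i ∈ Finset.range N, (c (n + i))⁻¹

theorem levelLen_succ' (c : ℕ → ℝ) (n N : ℕ) :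
    levelLen c n (N + 1) = (c n)⁻¹ * levelLen c (n + 1) N := by
  simp only [levelLen, Finset.prod_range_succ', add_assoc, add_comm 1, add_zero]
  ring

theorem levelLen_pos {c : ℕ → ℝ} (hc : ∀ n, 2 ≤ c n) (n N : ℕ) : 0 < levelLen c n N :=
  Finset.prod_pos fun i _ => inv_pos.2 (by linarith [hc (n + i)])

theorem two_mul_levelLen_succ_le {c : ℕ → ℝ} (hc : ∀ n, 2 ≤ c n) (n N : ℕ) :
    2 * levelLen c n (N + 1) ≤ levelLen c n N := by
  have h1 := hc (n + N)
  have h2 := levelLen_pos hc n N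
  have h3 : (c (n + N))⁻¹ ≤ 2⁻¹ := inv_anti₀ two_pos h1
  rw [levelLen, Finset.prod_range_succ, ← levelLen]
  nlinarith

theorem two_pow_mul_levelLen_add_le {c : ℕ → ℝ} (hc : ∀ n, 2 ≤ c n) (n N k : ℕ) :
    2 ^ k * levelLen c n (N + k) ≤ levelLen c n N := by
  induction k with
  | zero => simp
  | succ k ih =>
    have h1 := two_mul_levelLen_succ_le hc n (N + k)
    have h2 : (0 : ℝ) < 2 ^ k := by positivity
    rw [pow_succ, ← add_assoc]
    nlinarith

theorem moranCyl_snd (c : ℕ → ℝ) (w : List Bool) (n : ℕ) (st : ℝ × ℝ) :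
    (moranCyl c w n st).2 = st.2 * levelLen c n w.length := by
  induction w generalizing n st with
  | nil => simp [moranCyl, levelLen]
  | cons d w ih =>
    rw [moranCyl, ih, List.length_cons, levelLen_succ']
    split_ifs <;> simp only [div_eq_mul_inv] <;> ring

theorem moranCyl_subset {c : ℕ → ℝ} (hc : ∀ n, 2 ≤ c n) (w : List Bool) (n : ℕ) (st : ℝ × ℝ)
    (hst : 0 ≤ st.2) :
    Icc (moranCyl c w n st).1 ((moranCyl c w n st).1 + (moranCyl c w n st).2) ⊆
      Icc st.1 (st.1 + st.2) := by
  induction w generalizing n st with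
  | nil => exact subset_rfl
  | cons d w ih =>
    have h1 := hc n
    have h2 : st.2 / c n ≤ st.2 := div_le_self hst (by linarith)
    have h3 : 0 ≤ st.2 / c n := div_nonneg hst (by linarith)
    rw [moranCyl]
    refine (ih _ _ ?_).trans (Icc_subset_Icc ?_ ?_) <;> split_ifs <;> simp <;> linarith

theorem le_abs_sub_of_mem_moranCyl {c : ℕ → ℝ} {κ : ℝ} (hc : ∀ n, 2 ≤ c n) (hκ : 0 ≤ κ)
    (hcκ : ∀ n, κ ≤ 1 - 2 / c n) (w w' : List Bool) (hlen : w.length = w'.length) (hne : w ≠ w')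
    (n : ℕ) (st : ℝ × ℝ) (hst : 0 ≤ st.2) {y z : ℝ}
    (hy : y ∈ Icc (moranCyl c w n st).1 ((moranCyl c w n st).1 + (moranCyl c w n st).2))
    (hz : z ∈ Icc (moranCyl c w' n st).1 ((moranCyl c w' n st).1 + (moranCyl c w' n st).2)) :
    κ * (st.2 * levelLen c n w.length) ≤ |y - z| := by
  induction w generalizing w' n st with
  | nil => exact absurd (List.length_eq_zero_iff.1 hlen.symm).symm hne
  | cons d w ih =>
    cases w' with
    | nil => simp at hlen
    | cons d' w' =>
      have h1 := hc n
      have h3 : 0 ≤ st.2 / c n := div_nonneg hst (by linarith)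
      rw [List.length_cons, levelLen_succ']
      by_cases hd : d = d'
      · subst hd
        have hne' : w ≠ w' := by rintro rfl; exact hne rfl
        have := ih w' (by simpa using hlen) hne' (n + 1) _ (by split_ifs <;> simpa using h3) hy hz
        convert this using 2
        split_ifs <;> simp only [div_eq_mul_inv] <;> ring
      · have hy' := moranCyl_subset hc w (n + 1) _ (by split_ifs <;> simpa using h3) hy
        have hz' := moranCyl_subset hc w' (n + 1) _ (by split_ifs <;> simpa using h3) hz
        have hgap : κ * (st.2 * ((c n)⁻¹ * levelLen c (n + 1) w.length)) ≤
            st.2 - 2 * (st.2 / c n) := by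
          have h4 : (c n)⁻¹ * levelLen c (n + 1) w.length ≤ 1 := by
            rw [← levelLen_succ']
            have h5 := two_pow_mul_levelLen_add_le hc n 0 (w.length + 1)
            have h6 : (1 : ℝ) ≤ 2 ^ (w.length + 1) := one_le_pow₀ one_le_two
            have h7 := levelLen_pos hc n (w.length + 1)
            simp only [zero_add] at h5
            have h8 : levelLen c n 0 = 1 := by simp [levelLen]
            nlinarith
          calc _ ≤ κ * (st.2 * 1) := by gcongr
            _ ≤ (1 - 2 / c n) * (st.2 * 1) := by gcongr; exact hcκ n
            _ = _ := by ring
        refine hgap.trans ?_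
        cases d <;> cases d' <;> simp at hd hy' hz'
        · rw [abs_sub_comm]
          exact le_trans (by linarith) (le_abs_self _)
        · exact le_trans (by linarith) (le_abs_self _)

theorem le_abs_sub_of_mem_moranI {c : ℕ → ℝ} {κ : ℝ} (hc : ∀ n, 2 ≤ c n) (hκ : 0 ≤ κ)
    (hcκ : ∀ n, κ ≤ 1 - 2 / c n) {N : ℕ} {w w' : List Bool} (hw : w ∈ binaryWords N)
    (hw' : w' ∈ binaryWords N) (hne : w ≠ w') {y z : ℝ} (hy : y ∈ moranI c w)
    (hz : z ∈ moranI c w') : κ * levelLen c 1 N ≤ |y - z| := by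
  have hl := length_of_mem_binaryWords hw
  have := le_abs_sub_of_mem_moranCyl hc hκ hcκ w w'
    (hl.trans (length_of_mem_binaryWords hw').symm) hne 1 (0, 1) zero_le_one hy hz
  simpa [hl] using this

theorem moranI_subset_closedBall (c : ℕ → ℝ) {N : ℕ} {w : List Bool} (hw : w ∈ binaryWords N)
    {x ρ : ℝ} (hx : x ∈ moranI c w) (hρ : levelLen c 1 N ≤ ρ) :
    moranI c w ⊆ closedBall x ρ := by
  intro y hy
  have h := moranCyl_snd c w 1 (0, 1)
  rw [length_of_mem_binaryWords hw, one_mul] at h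
  simp only [moranI, h, mem_Icc] at hx hy
  rw [mem_closedBall, Real.dist_eq, abs_le]
  constructor <;> linarith

theorem ae_mem_biUnion_moranI {c r : ℕ → ℝ} {κ : ℝ} (hc : ∀ n, 2 ≤ c n) (hκ : 0 < κ)
    (hcκ : ∀ n, κ ≤ 1 - 2 / c n) (h0 : ∀ n, 0 < r n) (h1 : ∀ n, r n < 1)
    (μ : Measure ℝ) [IsProbabilityMeasure μ]
    (hμ : ∀ w, μ (moranI c w) = ENNReal.ofReal (cylMass r w 1 1)) (N : ℕ) :
    ∀ᵐ x ∂μ, x ∈ ⋃ w ∈ binaryWords N, moranI c w := by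
  have hmeas : ∀ w, MeasurableSet (moranI c w) := fun w => measurableSet_Icc
  have hU : MeasurableSet (⋃ w ∈ binaryWords N, moranI c w) :=
    Finset.measurableSet_biUnion _ fun w _ => hmeas w
  refine (mem_ae_iff_prob_eq_one hU).2 ?_
  rw [measure_biUnion_finset _ fun w _ => hmeas w]
  · simp only [hμ]
    rw [← ENNReal.ofReal_sum_of_nonneg fun w _ => (cylMass_pos h0 h1 w 1 one_pos).le, sum_cylMass,
      ENNReal.ofReal_one]
  · intro w hw w' hw' hne
    refine Set.disjoint_left.2 fun y hy hz => ?_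
    have := le_abs_sub_of_mem_moranI hc hκ.le hcκ hw hw' hne hy hz
    have h2 := mul_pos hκ (levelLen_pos hc 1 N)
    simp at this
    linarith

theorem measure_closedBall_le_measure_moranI {c : ℕ → ℝ} {κ : ℝ} (hc : ∀ n, 2 ≤ c n) (hκ : 0 ≤ κ)
    (hcκ : ∀ n, κ ≤ 1 - 2 / c n) {μ : Measure ℝ} {N : ℕ}
    (hae : ∀ᵐ x ∂μ, x ∈ ⋃ w ∈ binaryWords N, moranI c w) {w : List Bool}
    (hw : w ∈ binaryWords N) {x ρ : ℝ} (hx : x ∈ moranI c w) (hρ : ρ < κ * levelLen c 1 N) :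
    μ (closedBall x ρ) ≤ μ (moranI c w) := by
  refine measure_mono_ae ?_
  filter_upwards [hae] with y hy hyB
  simp only [mem_iUnion, exists_prop] at hy
  obtain ⟨w', hw', hyw'⟩ := hy
  by_cases hne : w' = w
  · exact hne ▸ hyw'
  · have h2 := le_abs_sub_of_mem_moranI hc hκ hcκ hw' hw hne hyw' hx
    have h3 : |y - x| ≤ ρ := by simpa [Real.dist_eq] using mem_closedBall.1 hyB
    linarith

theorem ae_eventually_abs_log_cylMass_sub_le {c r : ℕ → ℝ} {H : ℝ} (h0 : ∀ n, 0 < r n)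
    (h1 : ∀ n, r n < 1) (hH0 : ∀ n, |Real.log (r n)| ≤ H)
    (hH1 : ∀ n, |Real.log (1 - r n)| ≤ H) (hH : 1 ≤ H) (μ : Measure ℝ)
    (hμ : ∀ w, μ (moranI c w) = ENNReal.ofReal (cylMass r w 1 1)) :
    ∀ᵐ x ∂μ, ∀ ε > 0, ∀ᶠ N : ℕ in atTop, ∀ w ∈ binaryWords N, x ∈ moranI c w →
      |Real.log (cylMass r w 1 1) - ∑ i ∈ Finset.range N, meanLog (r (1 + i))| ≤ ε * N := by
  have key : ∀ ε : ℝ, 0 < ε → ε ≤ 1 → ∀ᵐ x ∂μ, ∀ᶠ N : ℕ in atTop, ∀ w ∈ binaryWords N,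
      x ∈ moranI c w →
      |Real.log (cylMass r w 1 1) - ∑ i ∈ Finset.range N, meanLog (r (1 + i))| ≤ ε * N := by
    intro ε hε hε1
    set bad : ℕ → Finset (List Bool) := fun N => {w ∈ binaryWords N |
        ε * N < |Real.log (cylMass r w 1 1) - ∑ i ∈ Finset.range N, meanLog (r (1 + i))|} with hbad
    set q := Real.exp (-(ε ^ 2 / (16 * H ^ 2))) with hq
    have hq1 : q < 1 := Real.exp_lt_one_iff.2 (neg_lt_zero.2 (by positivity))
    have hsum : Summable fun N : ℕ => 2 * q ^ N :=
      (summable_geometric_of_lt_one (Real.exp_pos _).le hq1).mul_left 2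
    have hle : ∀ N, μ (⋃ w ∈ bad N, moranI c w) ≤ ENNReal.ofReal (2 * q ^ N) := by
      intro N
      refine (measure_biUnion_finset_le _ _).trans ?_
      simp only [hμ]
      rw [← ENNReal.ofReal_sum_of_nonneg fun w _ => (cylMass_pos h0 h1 w 1 one_pos).le]
      exact ENNReal.ofReal_le_ofReal (sum_cylMass_deviation_le h0 h1 hH0 hH1 hH hε hε1 N 1)
    have hfin : ∑' N, μ (⋃ w ∈ bad N, moranI c w) ≠ ⊤ :=
      ne_top_of_le_ne_top hsum.tsum_ofReal_ne_top (ENNReal.tsum_le_tsum hle)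
    filter_upwards [ae_eventually_notMem hfin] with x hx
    filter_upwards [hx] with N hN w hw hxw
    by_contra! hlt
    exact hN (mem_biUnion (show w ∈ bad N from Finset.mem_filter.2 ⟨hw, hlt⟩) hxw)
  have hall : ∀ᵐ x ∂μ, ∀ j : ℕ, ∀ᶠ N : ℕ in atTop, ∀ w ∈ binaryWords N, x ∈ moranI c w →
      |Real.log (cylMass r w 1 1) - ∑ i ∈ Finset.range N, meanLog (r (1 + i))| ≤
        1 / ((j : ℝ) + 1) * N :=
    ae_all_iff.2 fun j => key _ (by positivity)
      (by rw [div_le_one (by positivity)]; linarith [(Nat.cast_nonneg j : (0 : ℝ) ≤ j)])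
  filter_upwards [hall] with x hx ε hε
  obtain ⟨j, hj⟩ := exists_nat_one_div_lt hε
  filter_upwards [hx j] with N hN w hw hxw
  exact (hN w hw hxw).trans (by gcongr)

/-- The first level at which the cylinders have length at most `ρ`. -/
noncomputable def levelAt (c : ℕ → ℝ) (ρ : ℝ) : ℕ := sInf {n | levelLen c 1 n ≤ ρ}

theorem levelLen_antitone {c : ℕ → ℝ} (hc : ∀ n, 2 ≤ c n) (n : ℕ) : Antitone (levelLen c n) :=
  antitone_nat_of_succ_le fun N => by
    linarith [two_mul_levelLen_succ_le hc n N, levelLen_pos hc n (N + 1)]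

theorem levelLen_levelAt_le {c : ℕ → ℝ} (hc : ∀ n, 2 ≤ c n) {ρ : ℝ} (hρ : 0 < ρ) :
    levelLen c 1 (levelAt c ρ) ≤ ρ := by
  refine Nat.sInf_mem (s := {n | levelLen c 1 n ≤ ρ}) ?_
  obtain ⟨n, hn⟩ := exists_pow_lt_of_lt_one hρ (one_half_lt_one (α := ℝ))
  refine ⟨n, le_trans ?_ hn.le⟩
  have h := two_pow_mul_levelLen_add_le hc 1 0 n
  have h8 : levelLen c 1 0 = 1 := by simp [levelLen]
  rw [zero_add, h8] at h
  rw [one_div, inv_pow, ← one_div, le_div_iff₀' (by positivity)]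
  exact h

theorem lt_levelLen_of_lt_levelAt {c : ℕ → ℝ} {ρ : ℝ} {n : ℕ} (hn : n < levelAt c ρ) :
    ρ < levelLen c 1 n :=
  not_le.1 fun h => Nat.notMem_of_lt_sInf hn h

theorem tendsto_levelAt {c : ℕ → ℝ} (hc : ∀ n, 2 ≤ c n) :
    Tendsto (levelAt c) (𝓝[>] 0) atTop := by
  refine tendsto_atTop.2 fun n => ?_
  filter_upwards [Ioo_mem_nhdsGT (levelLen_pos hc 1 n)] with ρ hρ
  by_contra! hlt
  exact absurd (levelLen_antitone hc 1 hlt.le |>.trans (levelLen_levelAt_le hc hρ.1)) (not_le.2 hρ.2)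

theorem levelAt_le_four_mul_abs_log {c : ℕ → ℝ} (hc : ∀ n, 2 ≤ c n) {ρ : ℝ} (hρ : 0 < ρ)
    (h2 : 2 ≤ levelAt c ρ) : (levelAt c ρ : ℝ) ≤ 4 * |Real.log ρ| := by
  obtain ⟨N, hN⟩ : ∃ N, levelAt c ρ = N + 1 := ⟨levelAt c ρ - 1, by omega⟩
  have h3 := lt_levelLen_of_lt_levelAt (c := c) (ρ := ρ) (n := N) (by omega)
  have h := two_pow_mul_levelLen_add_le hc 1 0 N
  have h8 : levelLen c 1 0 = 1 := by simp [levelLen]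
  rw [zero_add, h8] at h
  have h4 : 2 ^ N * ρ ≤ 1 := (mul_le_mul_of_nonneg_left h3.le (by positivity)).trans h
  have h5 := Real.log_le_log (by positivity) h4
  rw [Real.log_mul (by positivity) hρ.ne', Real.log_pow, Real.log_one] at h5
  have h6 : (1 : ℝ) ≤ N := by exact_mod_cast (by omega : 1 ≤ N)
  rw [hN]
  push_cast
  nlinarith [Real.log_two_gt_d9, neg_abs_le (Real.log ρ)]

theorem limsup_le_limsup_of_tendsto_sub {ι : Type*} {l : Filter ι} [l.NeBot] {f g : ι → ℝ} {K : ℝ}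
    (hg : ∀ᶠ i in l, |g i| ≤ K) (hf : ∀ᶠ i in l, |f i| ≤ K)
    (h : Tendsto (fun i => f i - g i) l (𝓝 0)) : limsup f l ≤ limsup g l := by
  have bdd : ∀ {u : ι → ℝ}, (∀ᶠ i in l, |u i| ≤ K) →
      l.IsBoundedUnder (· ≤ ·) u ∧ l.IsCoboundedUnder (· ≤ ·) u := fun hu =>
    ⟨isBoundedUnder_of_eventually_le (a := K) (hu.mono fun i hi => (abs_le.1 hi).2),
      (isBoundedUnder_of_eventually_ge (a := -K)
        (hu.mono fun i hi => (abs_le.1 hi).1)).isCoboundedUnder_le⟩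
  refine le_of_forall_pos_le_add fun ε hε => ?_
  rw [← limsup_add_const l g ε (bdd hg).1 (bdd hg).2]
  refine limsup_le_limsup ?_ (bdd hf).2 ?_
  · filter_upwards [h.eventually_lt_const hε] with i hi
    linarith
  · exact isBoundedUnder_of_eventually_le (a := K + ε)
      (hg.mono fun i hi => by linarith [(abs_le.1 hi).2])

theorem limsup_eq_limsup_of_tendsto_sub {ι : Type*} {l : Filter ι} [l.NeBot] {f g : ι → ℝ} {K : ℝ}
    (hg : ∀ᶠ i in l, |g i| ≤ K) (h : Tendsto (fun i => f i - g i) l (𝓝 0)) :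
    limsup f l = limsup g l := by
  have hf : ∀ᶠ i in l, |f i| ≤ K + 1 := by
    filter_upwards [hg, h.abs.eventually_lt_const (u := 1) (by simp)] with i h1 h2
    linarith [abs_sub_abs_le_abs_sub (f i) (g i)]
  have hg' : ∀ᶠ i in l, |g i| ≤ K + 1 := hg.mono fun i hi => by linarith
  refine le_antisymm (limsup_le_limsup_of_tendsto_sub hg' hf h)
    (limsup_le_limsup_of_tendsto_sub hf hg' ?_)
  simpa using h.neg

theorem liminf_eq_neg_limsup_neg {ι : Type*} (l : Filter ι) (f : ι → ℝ) :
    liminf f l = -limsup (fun i => -f i) l := by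
  rw [liminf_eq, limsup_eq, ← Real.sSup_neg]
  congr 1
  ext y
  simp

theorem liminf_eq_liminf_of_tendsto_sub {ι : Type*} {l : Filter ι} [l.NeBot] {f g : ι → ℝ} {K : ℝ}
    (hg : ∀ᶠ i in l, |g i| ≤ K) (h : Tendsto (fun i => f i - g i) l (𝓝 0)) :
    liminf f l = liminf g l := by
  rw [liminf_eq_neg_limsup_neg, liminf_eq_neg_limsup_neg,
    limsup_eq_limsup_of_tendsto_sub (g := fun i => -g i) (K := K) (by simpa using hg)]
  have := h.neg
  simp only [neg_zero] at this
  exact this.congr fun i => by ring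

theorem abs_sum_meanLog_le {r : ℕ → ℝ} {H : ℝ} (h0 : ∀ n, 0 < r n) (h1 : ∀ n, r n < 1)
    (hH0 : ∀ n, |Real.log (r n)| ≤ H) (hH1 : ∀ n, |Real.log (1 - r n)| ≤ H) (n N : ℕ) :
    |∑ i ∈ Finset.range N, meanLog (r (n + i))| ≤ H * N := by
  refine (Finset.abs_sum_le_sum_abs _ _).trans ((Finset.sum_le_card_nsmul _ _ H fun i _ =>
    abs_meanLog_le (h0 _) (h1 _) (hH0 _) (hH1 _)).trans (le_of_eq ?_))
  simp [mul_comm]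

theorem ae_tendsto_localDim_sub {c r : ℕ → ℝ} {κ H : ℝ} (hc : ∀ n, 2 ≤ c n) (hκ : 0 < κ)
    (hcκ : ∀ n, κ ≤ 1 - 2 / c n) (h0 : ∀ n, 0 < r n) (h1 : ∀ n, r n < 1)
    (hH0 : ∀ n, |Real.log (r n)| ≤ H) (hH1 : ∀ n, |Real.log (1 - r n)| ≤ H) (hH : 1 ≤ H)
    (μ : Measure ℝ) [IsProbabilityMeasure μ]
    (hμ : ∀ w, μ (moranI c w) = ENNReal.ofReal (cylMass r w 1 1)) :
    ∀ᵐ x ∂μ, Tendsto (fun ρ : ℝ => Real.log (μ (closedBall x ρ)).toReal / Real.log ρ -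
      (∑ i ∈ Finset.range (levelAt c ρ), meanLog (r (1 + i))) / Real.log ρ) (𝓝[>] 0) (𝓝 0) := by
  have hcyl := ae_mem_biUnion_moranI hc hκ hcκ h0 h1 μ hμ
  obtain ⟨k, hk⟩ := pow_unbounded_of_one_lt κ⁻¹ one_lt_two (R := ℝ)
  have hk1 : 1 ≤ κ * 2 ^ k := by
    rw [inv_lt_iff_one_lt_mul₀' hκ] at hk
    exact hk.le
  set m : ℕ → ℝ := fun N => ∑ i ∈ Finset.range N, meanLog (r (1 + i)) with hm
  have hpos := fun w => cylMass_pos h0 h1 w 1 one_pos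
  filter_upwards [ae_all_iff.2 hcyl,
    ae_eventually_abs_log_cylMass_sub_le h0 h1 hH0 hH1 hH μ hμ] with x hx hdev
  refine Metric.tendsto_nhds.2 fun ε hε => ?_
  set δ := ε / 16 with hδ
  have hδ0 : 0 < δ := by positivity
  obtain ⟨N₀, hN₀⟩ := eventually_atTop.1 (hdev δ hδ0)
  obtain ⟨N₁, hN₁⟩ := exists_nat_gt (H * (k + 1) / δ)
  rw [div_lt_iff₀ hδ0] at hN₁
  filter_upwards [self_mem_nhdsWithin,
    (tendsto_levelAt hc).eventually_ge_atTop (N₀ + N₁ + k + 2)] with ρ hρ hM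
  have hρ0 : 0 < ρ := hρ
  obtain ⟨j, hj⟩ : ∃ j, levelAt c ρ = j + k + 1 := ⟨levelAt c ρ - k - 1, by omega⟩
  have hbig := levelAt_le_four_mul_abs_log hc hρ0 (by omega)
  set M := levelAt c ρ with hMdef
  have hu := hx M
  have hw := hx j
  simp only [mem_iUnion, exists_prop] at hu hw
  obtain ⟨u, hu, hxu⟩ := hu
  obtain ⟨w, hw, hxw⟩ := hw
  have hdu := abs_le.1 (hN₀ M (by omega) u hu hxu)
  have hdw := abs_le.1 (hN₀ j (by omega) w hw hxw)
  have hlo : cylMass r u 1 1 ≤ (μ (closedBall x ρ)).toReal := by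
    rw [← ENNReal.ofReal_le_iff_le_toReal (measure_ne_top _ _), ← hμ]
    exact measure_mono (moranI_subset_closedBall c hu hxu (levelLen_levelAt_le hc hρ0))
  have hlt : ρ < κ * levelLen c 1 j := by
    have h3 := two_pow_mul_levelLen_add_le hc 1 j k
    have h4 := lt_levelLen_of_lt_levelAt (c := c) (ρ := ρ) (n := j + k) (by omega)
    have h5 := mul_le_mul_of_nonneg_left h3 hκ.le
    have h6 := levelLen_pos hc 1 (j + k)
    nlinarith
  have hhi : (μ (closedBall x ρ)).toReal ≤ cylMass r w 1 1 := by
    refine ENNReal.toReal_le_of_le_ofReal (hpos w).le ?_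
    rw [← hμ]
    exact measure_closedBall_le_measure_moranI hc hκ.le hcκ (hcyl j) hw hxw hlt
  have hllo := Real.log_le_log (hpos u) hlo
  have hlhi := Real.log_le_log ((hpos u).trans_le hlo) hhi
  have hmdiff : |m M - m j| ≤ H * (k + 1) := by
    have h3 := abs_sum_meanLog_le h0 h1 hH0 hH1 (1 + j) (k + 1)
    have h4 : m M - m j = ∑ i ∈ Finset.range (k + 1), meanLog (r (1 + j + i)) := by
      simp only [hm, hj, add_assoc j k 1, Finset.sum_range_add, add_sub_cancel_left, add_assoc]
    rw [h4]
    exact_mod_cast h3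
  have hmd := abs_le.1 hmdiff
  have hjM : (j : ℝ) ≤ M := by exact_mod_cast (by omega : j ≤ M)
  have hNM : (N₁ : ℝ) ≤ M := by exact_mod_cast (by omega : N₁ ≤ M)
  have hM0 : (0 : ℝ) < M := by exact_mod_cast (by omega : 0 < M)
  have hmain : |Real.log (μ (closedBall x ρ)).toReal - m M| ≤ 2 * δ * M := by
    rw [abs_le]
    constructor <;> nlinarith
  have hlog : 0 < |Real.log ρ| := by linarith
  rw [Real.dist_eq, sub_zero, ← sub_div, abs_div, div_lt_iff₀ hlog]
  calc _ ≤ 2 * δ * M := hmain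
    _ < ε * |Real.log ρ| := by nlinarith

/-- assume a ≤ p'_n ≤ b and 2 < inf_n A_n ≤ sup_n A_n < ∞.  Then ν' is
exact upper and lower dimensional: there are constants c₁, c₂ such that for ν'-almost
every x, the lower local dimension equals c₁ and the upper local dimension equals c₂. -/
theorem stmt_18 (A : ℕ → ℝ) (a b : ℝ) (p p' : ℕ → ℝ)
    (hA : ∀ n : ℕ, 2 ≤ A n)
    (ha0 : 0 < a) (hab : a ≤ b) (hb1 : b < 1)
    (hp : ∀ n : ℕ, a ≤ p n ∧ p n ≤ b)
    (hp' : ∀ n : ℕ, a ≤ p' n ∧ p' n ≤ b)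
    (hinf : 2 < ⨅ n : ℕ, A n) (hbdd : BddAbove (Set.range A))
    (ν ν' : Measure ℝ) [IsProbabilityMeasure ν] [IsProbabilityMeasure ν']
    (hν : ∀ w : List Bool, ν (moranI A w) = ENNReal.ofReal (cylMass p w 1 1))
    (hν' : ∀ w : List Bool, ν' (moranI A w) = ENNReal.ofReal (cylMass p' w 1 1)) :
    ∃ c₁ c₂ : ℝ,
      (∀ᵐ x ∂ν', lowerLocalDim ν' x = c₁) ∧
      (∀ᵐ x ∂ν', upperLocalDim ν' x = c₂) := by
  have h0 : ∀ n, 0 < p' n := fun n => ha0.trans_le (hp' n).1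
  have h1 : ∀ n, p' n < 1 := fun n => (hp' n).2.trans_lt hb1
  set δ := ⨅ n, A n with hδ
  have hδA : ∀ n, δ ≤ A n := ciInf_le ⟨2, by rintro _ ⟨n, rfl⟩; exact hA n⟩
  have hκ : 0 < 1 - 2 / δ := by
    rw [sub_pos, div_lt_one (by linarith)]
    exact hinf
  have hcκ : ∀ n, 1 - 2 / δ ≤ 1 - 2 / A n := fun n => by
    have := div_le_div_of_nonneg_left (zero_le_two (α := ℝ)) (by linarith) (hδA n)
    linarith
  set H := 1 + |Real.log a| + |Real.log (1 - b)| with hH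
  have hH1 : 1 ≤ H := by linarith [abs_nonneg (Real.log a), abs_nonneg (Real.log (1 - b))]
  have hlog : ∀ q s : ℝ, 0 < q → q ≤ s → s < 1 → |Real.log s| ≤ |Real.log q| := fun q s hq hqs hs => by
    have h2 := Real.log_le_log hq hqs
    have h3 := Real.log_nonpos (hq.trans_le hqs).le hs.le
    rw [abs_of_nonpos h3, abs_of_nonpos (h2.trans h3)]
    linarith
  have hHp : ∀ n, |Real.log (p' n)| ≤ H := fun n => by
    linarith [hlog a (p' n) ha0 (hp' n).1 (h1 n), abs_nonneg (Real.log (1 - b))]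
  have hHq : ∀ n, |Real.log (1 - p' n)| ≤ H := fun n => by
    linarith [hlog (1 - b) (1 - p' n) (by linarith) (by linarith [(hp' n).2])
      (by linarith [h0 n]), abs_nonneg (Real.log a)]
  have hae := ae_tendsto_localDim_sub hA hκ hcκ h0 h1 hHp hHq hH1 ν' hν'
  set g : ℝ → ℝ := fun ρ =>
    (∑ i ∈ Finset.range (levelAt A ρ), meanLog (p' (1 + i))) / Real.log ρ with hg
  have hgb : ∀ᶠ ρ in 𝓝[>] (0 : ℝ), |g ρ| ≤ 4 * H := by
    filter_upwards [self_mem_nhdsWithin, (tendsto_levelAt hA).eventually_ge_atTop 2] with ρ hρ hM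
    have h3 := levelAt_le_four_mul_abs_log hA hρ hM
    have h4 := abs_sum_meanLog_le h0 h1 hHp hHq 1 (levelAt A ρ)
    rw [hg, abs_div]
    refine div_le_of_le_mul₀ (abs_nonneg _) (by linarith) (h4.trans ?_)
    nlinarith
  refine ⟨liminf g (𝓝[>] 0), limsup g (𝓝[>] 0), ?_, ?_⟩
  · filter_upwards [hae] with x hx
    exact liminf_eq_liminf_of_tendsto_sub hgb hx
  · filter_upwards [hae] with x hx
    exact limsup_eq_limsup_of_tendsto_sub hgb hx
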